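/- arXiv:1805.01538 — 9 statements merged into one kernel-verified Lean document; each statement's English description precedes it below -/
import Mathlib

section
/- For all integers m, n, r with n ≠ 0 (so that F(n) ≠ 0) and every nonnegative integer k: F(r) · ∑_{j=0}^{k} (-1)^{r·j} (F(n+r)/F(n))^j · G(m+n+r+r·j) = (-1)^{k·r} · F(n) · (F(n+r)/F(n))^{k+1} · G(m+(k+1)·r) − (-1)^r · F(n) · G(m). -/
/-- A solution of the Fibonacci recurrence on `ℤ` vanishing at `0` and `1` vanishes everywhere. -/
theorem fibRec_eq_zero (H : ℤ → ℝ) (hH : ∀ m : ℤ, H m = H (m - 1) + H (m - 2))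
    (h0 : H 0 = 0) (h1 : H 1 = 0) (n : ℤ) : H n = 0 := by
  suffices h : H n = 0 ∧ H (n + 1) = 0 from h.1
  induction n using Int.induction_on with
  | zero => simpa using ⟨h0, h1⟩
  | succ i ih =>
    refine ⟨ih.2, ?_⟩
    rw [hH, show (i : ℤ) + 1 + 1 - 1 = i + 1 by ring, show (i : ℤ) + 1 + 1 - 2 = i by ring,
      ih.1, ih.2, add_zero]
  | pred i ih =>
    have h := hH (-i + 1)
    rw [show -(i : ℤ) + 1 - 1 = -i by ring, show -(i : ℤ) + 1 - 2 = -i - 1 by ring,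
      ih.1, ih.2] at h
    refine ⟨by linarith, ?_⟩
    rw [sub_add_cancel]
    exact ih.1

/-- A Cassini-type identity for a generalized Fibonacci sequence `G`. -/
theorem fib_cassini (F G : ℤ → ℝ) (hF0 : F 0 = 0) (hF1 : F 1 = 1)
    (hF : ∀ m : ℤ, F m = F (m - 1) + F (m - 2))
    (hG : ∀ m : ℤ, G m = G (m - 1) + G (m - 2)) (m r : ℤ) :
    F r * G (m + r + 1) - F (r + 1) * G (m + r) + (-1 : ℝ) ^ r * G m = 0 := by
  have step (r : ℤ) : F (r + 1) * G (m + (r + 1) + 1) - F (r + 1 + 1) * G (m + (r + 1))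
      + (-1 : ℝ) ^ (r + 1) * G m
      = -(F r * G (m + r + 1) - F (r + 1) * G (m + r) + (-1 : ℝ) ^ r * G m) := by
    rw [hF (r + 1 + 1), hG (m + (r + 1) + 1), zpow_add_one₀ (by norm_num),
      show r + 1 + 1 - 1 = r + 1 by ring, show r + 1 + 1 - 2 = r by ring,
      show m + (r + 1) + 1 - 1 = m + r + 1 by ring, show m + (r + 1) + 1 - 2 = m + r by ring,
      show m + (r + 1) = m + r + 1 by ring]
    ring
  induction r using Int.induction_on with
  | zero => simp [hF0, hF1]
  | succ i ih => rw [step, ih, neg_zero]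
  | pred i ih =>
    have h := step (-i - 1)
    rw [sub_add_cancel, ih] at h
    rw [sub_add_cancel]
    linarith

/-- A d'Ocagne-type identity for a generalized Fibonacci sequence `G`. -/
theorem fib_mul_eq_sub (F G : ℤ → ℝ) (hF0 : F 0 = 0) (hF1 : F 1 = 1)
    (hF : ∀ m : ℤ, F m = F (m - 1) + F (m - 2))
    (hG : ∀ m : ℤ, G m = G (m - 1) + G (m - 2)) (m n r : ℤ) :
    F r * G (m + n + r) = F (n + r) * G (m + r) - (-1 : ℝ) ^ r * F n * G m := by
  have h := fibRec_eq_zero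
    (fun n ↦ F r * G (m + n + r) - F (n + r) * G (m + r) + (-1 : ℝ) ^ r * F n * G m)
    (fun n ↦ by
      rw [hG (m + n + r), hF (n + r), hF n,
        show m + n + r - 1 = m + (n - 1) + r by ring,
        show m + n + r - 2 = m + (n - 2) + r by ring,
        show n + r - 1 = n - 1 + r by ring, show n + r - 2 = n - 2 + r by ring]
      ring)
    (by simp [hF0])
    (by
      have h := fib_cassini F G hF0 hF1 hF hG m r
      rw [hF1, show m + 1 + r = m + r + 1 by ring, add_comm 1 r, mul_one]
      exact h) n
  linarith

theorem fib_natCast (F : ℤ → ℝ) (hF0 : F 0 = 0) (hF1 : F 1 = 1)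
    (hF : ∀ m : ℤ, F m = F (m - 1) + F (m - 2)) (n : ℕ) : F n = Nat.fib n := by
  induction n using Nat.twoStepInduction with
  | zero => simp [hF0]
  | one => simp [hF1]
  | more n ih₀ ih₁ =>
    rw [hF, Nat.fib_add_two, show ((n + 2 : ℕ) : ℤ) - 1 = (n + 1 : ℕ) by push_cast; ring,
      show ((n + 2 : ℕ) : ℤ) - 2 = n by push_cast; ring, ih₀, ih₁]
    push_cast
    ring

theorem fib_ne_zero (F : ℤ → ℝ) (hF0 : F 0 = 0) (hF1 : F 1 = 1)
    (hF : ∀ m : ℤ, F m = F (m - 1) + F (m - 2)) (n : ℤ) (hn : n ≠ 0) : F n ≠ 0 := by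
  have hpos (k : ℕ) (hk : (k : ℤ) ≠ 0) : F k ≠ 0 := by
    rw [fib_natCast F hF0 hF1 hF]
    exact_mod_cast (Nat.fib_pos.2 (by omega)).ne'
  obtain ⟨k, rfl | rfl⟩ := n.eq_nat_or_neg
  · exact hpos k hn
  · intro h0
    have h := fib_cassini F F hF0 hF1 hF hF (-k) k
    rw [neg_add_cancel, zero_add, hF0, hF1, h0] at h
    exact hpos k (by simpa using hn) (by linarith)

/-- Weighted sum identity for generalized Fibonacci sequences
(Adegoke, Theorem 2, first identity). -/
theorem stmt_0 (F G : ℤ → ℝ)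
    (hF0 : F 0 = 0) (hF1 : F 1 = 1)
    (hF : ∀ m : ℤ, F m = F (m - 1) + F (m - 2))
    (hG : ∀ m : ℤ, G m = G (m - 1) + G (m - 2))
    (m n r : ℤ) (hn : n ≠ 0) (k : ℕ) :
    F r * ∑ j ∈ Finset.range (k + 1),
        (-1 : ℝ) ^ (r * (j : ℤ)) * (F (n + r) / F n) ^ j * G (m + n + r + r * j)
      = (-1 : ℝ) ^ ((k : ℤ) * r) * F n * (F (n + r) / F n) ^ (k + 1)
          * G (m + (k + 1) * r)
        - (-1 : ℝ) ^ r * F n * G m := by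
  have hFn := fib_ne_zero F hF0 hF1 hF n hn
  have key := fib_mul_eq_sub F G hF0 hF1 hF hG
  have hq : F (n + r) = F (n + r) / F n * F n := (div_mul_cancel₀ _ hFn).symm
  generalize F (n + r) / F n = q at hq ⊢
  have hsq : (-1 : ℝ) ^ r * (-1 : ℝ) ^ r = 1 := by
    rw [← mul_zpow]
    norm_num
  induction k with
  | zero =>
    have h := key m n r
    rw [hq] at h
    simp
    linarith
  | succ k ih =>
    have h := key (m + (k + 1) * r) n r
    rw [hq] at h
    rw [Finset.sum_range_succ, mul_add, ih]
    push_cast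
    rw [show m + n + r + r * ((k : ℤ) + 1) = m + (k + 1) * r + n + r by ring,
      show m + ((k : ℤ) + 1 + 1) * r = m + (k + 1) * r + r by ring,
      show r * ((k : ℤ) + 1) = k * r + r by ring, show ((k : ℤ) + 1) * r = k * r + r by ring,
      zpow_add₀ (by norm_num)]
    rw [show ((k : ℤ) + 1) * r = k * r + r by ring] at h
    linear_combination (-1 : ℝ) ^ ((k : ℤ) * r) * (-1 : ℝ) ^ r * q ^ (k + 1) * h
      - (-1 : ℝ) ^ ((k : ℤ) * r) * q ^ (k + 1) * F n * G (m + (k * r + r)) * hsq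
end

section
/- For all integers m, n, r with n+r ≠ 0 (so that F(n+r) ≠ 0) and every nonnegative integer k: ∑_{j=0}^{k} (-1)^j · C(k,j) · (F(r)/F(r+n))^j · G(m+r·k+n·j) = (-1)^{r·k} · (F(n)/F(r+n))^k · G(m), where C(k,j) denotes the binomial coefficient. -/
/-- A sequence on `ℤ` satisfying the Fibonacci recurrence and vanishing at `0` and `1` is zero. -/
theorem eq_zero_of_fib_rec {H : ℤ → ℝ} (hH : ∀ m : ℤ, H m = H (m - 1) + H (m - 2))
    (h0 : H 0 = 0) (h1 : H 1 = 0) (n : ℤ) : H n = 0 := by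
  suffices h : H n = 0 ∧ H (n + 1) = 0 from h.1
  induction n using Int.induction_on with
  | zero => simpa using ⟨h0, h1⟩
  | succ i ih =>
    have h := hH (i + 1 + 1)
    rw [show (i : ℤ) + 1 + 1 - 1 = i + 1 by ring, show (i : ℤ) + 1 + 1 - 2 = i by ring] at h
    exact ⟨ih.2, by linarith [ih.1, ih.2]⟩
  | pred i ih =>
    have h := hH (-i + 1)
    rw [show -(i : ℤ) + 1 - 1 = -i by ring, show -(i : ℤ) + 1 - 2 = -i - 1 by ring] at h
    rw [sub_add_cancel]
    exact ⟨by linarith [ih.1, ih.2], ih.1⟩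

/-- The normalized solution of the Fibonacci recurrence on `ℤ` is `Int.fib`. -/
theorem eq_intFib_of_fib_rec {F : ℤ → ℝ} (hF0 : F 0 = 0) (hF1 : F 1 = 1)
    (hF : ∀ m : ℤ, F m = F (m - 1) + F (m - 2)) (n : ℤ) : F n = Int.fib n := by
  refine sub_eq_zero.mp (eq_zero_of_fib_rec (H := fun n => F n - Int.fib n) (fun m => ?_)
    (by simp [hF0]) (by simp [hF1]) n)
  have h := Int.fib_add_two (m - 2)
  rw [sub_add_cancel, show m - 2 + 1 = m - 1 by ring] at h
  simp only [h, hF m]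
  push_cast
  ring

/-- Consecutive-index case of `fib_mul_sub_fib_mul`. -/
theorem fib_succ_mul_sub_fib_mul_succ {F G : ℤ → ℝ} (hF0 : F 0 = 0) (hF1 : F 1 = 1)
    (hF : ∀ m : ℤ, F m = F (m - 1) + F (m - 2))
    (hG : ∀ m : ℤ, G m = G (m - 1) + G (m - 2)) (m r : ℤ) :
    F (r + 1) * G (m + r) - F r * G (m + r + 1) = (-1) ^ r * G m := by
  have step (s : ℤ) : F (s + 1 + 1) * G (m + (s + 1)) - F (s + 1) * G (m + (s + 1) + 1)
      = -(F (s + 1) * G (m + s) - F s * G (m + s + 1)) := by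
    have h1 := hF (s + 1 + 1)
    have h2 := hG (m + (s + 1) + 1)
    rw [show s + 1 + 1 - 1 = s + 1 by ring, show s + 1 + 1 - 2 = s by ring] at h1
    rw [show m + (s + 1) + 1 - 1 = m + s + 1 by ring,
      show m + (s + 1) + 1 - 2 = m + s by ring] at h2
    rw [h1, h2, ← add_assoc m s 1]
    ring
  induction r using Int.induction_on with
  | zero => simp [hF0, hF1]
  | succ i ih =>
    rw [step, ih, zpow_add_one₀ (by norm_num)]
    ring
  | pred i ih =>
    have h := step (-i - 1)
    rw [sub_add_cancel, ih] at h
    rw [sub_add_cancel, zpow_sub_one₀ (by norm_num), inv_neg_one]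
    linarith

/-- The Ocagne identity for a generalized Fibonacci sequence. -/
theorem fib_mul_sub_fib_mul {F G : ℤ → ℝ} (hF0 : F 0 = 0) (hF1 : F 1 = 1)
    (hF : ∀ m : ℤ, F m = F (m - 1) + F (m - 2))
    (hG : ∀ m : ℤ, G m = G (m - 1) + G (m - 2)) (m n r : ℤ) :
    F (r + n) * G (m + r) - F r * G (m + r + n) = (-1) ^ r * F n * G m := by
  refine sub_eq_zero.mp (eq_zero_of_fib_rec
    (H := fun n => F (r + n) * G (m + r) - F r * G (m + r + n) - (-1) ^ r * F n * G m)
    (fun n => ?_) (by simp [hF0]) ?_ n)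
  · simp only [hF (r + n), hG (m + r + n), hF n, add_sub_assoc]
    ring
  · simp only [hF1, fib_succ_mul_sub_fib_mul_succ hF0 hF1 hF hG]
    ring

/-- Iterating a three-term relation `G (m + r) - a * G (m + r + n) = c * G m` `k` times. -/
theorem sum_choose_mul_of_three_term {G : ℤ → ℝ} {a c : ℝ} {n r : ℤ}
    (h : ∀ m, G (m + r) - a * G (m + r + n) = c * G m) (k : ℕ) (m : ℤ) :
    ∑ j ∈ Finset.range (k + 1), (-1 : ℝ) ^ j * (Nat.choose k j : ℝ) * a ^ j
      * G (m + r * k + n * j) = c ^ k * G m := by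
  induction k generalizing m with
  | zero => simp
  | succ k ih =>
    have key := Finset.sum_choose_succ_mul
      (fun j _ => (-1 : ℝ) ^ j * a ^ j * G (m + r * (k + 1 : ℕ) + n * j)) k
    calc
      _ = ∑ j ∈ Finset.range (k + 2), ((k + 1).choose j : ℝ) *
          ((-1 : ℝ) ^ j * a ^ j * G (m + r * (k + 1 : ℕ) + n * j)) :=
        Finset.sum_congr rfl fun j _ => by ring
      _ = c ^ k * G (m + r) - a * (c ^ k * G (m + r + n)) := by
        rw [key, ← ih, ← ih, Finset.mul_sum, sub_eq_add_neg, ← Finset.sum_neg_distrib]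
        congr 1 <;> refine Finset.sum_congr rfl fun j _ => ?_
        · rw [show m + r * (k + 1 : ℕ) + n * j = m + r + r * k + n * j by push_cast; ring]
          ring
        · rw [show m + r * (k + 1 : ℕ) + n * (j + 1 : ℕ) = m + r + n + r * k + n * j by
            push_cast; ring]
          ring
      _ = c ^ (k + 1) * G m := by linear_combination c ^ k * h m

/-- Weighted binomial sum identity for generalized Fibonacci sequences
(Adegoke, Theorem 5, identity (15)). -/
theorem stmt_3 (F G : ℤ → ℝ)
    (hF0 : F 0 = 0) (hF1 : F 1 = 1)
    (hF : ∀ m : ℤ, F m = F (m - 1) + F (m - 2))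
    (hG : ∀ m : ℤ, G m = G (m - 1) + G (m - 2))
    (m n r : ℤ) (hnr : n + r ≠ 0) (k : ℕ) :
    ∑ j ∈ Finset.range (k + 1),
        (-1 : ℝ) ^ j * (Nat.choose k j : ℝ) * (F r / F (r + n)) ^ j
          * G (m + r * k + n * j)
      = (-1 : ℝ) ^ (r * (k : ℤ)) * (F n / F (r + n)) ^ k * G m := by
  have hne : F (r + n) ≠ 0 := by
    rw [eq_intFib_of_fib_rec hF0 hF1 hF, Int.cast_ne_zero, Ne, Int.fib_eq_zero, add_comm]
    exact hnr
  rw [sum_choose_mul_of_three_term (c := (-1) ^ r * (F n / F (r + n))) (fun m => ?_), mul_pow,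
    zpow_mul, zpow_natCast]
  have h := fib_mul_sub_fib_mul hF0 hF1 hF hG m n r
  field_simp
  linarith
end

section
/- For all integers m, n, r with n ≠ 0 (so that F(n) ≠ 0) and every nonnegative integer k: ∑_{j=0}^{k} (-1)^j · (-1)^{r·j} · C(k,j) · (F(n+r)/F(n))^j · G(m−(n+r)·k+r·j) = (-1)^k · (-1)^{r·k} · (F(r)/F(n))^k · G(m), where C(k,j) denotes the binomial coefficient. -/
/-- A two-sided sequence satisfying the Fibonacci recurrence that vanishes at `0` and `1` is zero. -/
theorem fibonacci_recurrence_eq_zero {H : ℤ → ℝ} (hH : ∀ m : ℤ, H m = H (m - 1) + H (m - 2))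
    (h0 : H 0 = 0) (h1 : H 1 = 0) (m : ℤ) : H m = 0 := by
  suffices h : H m = 0 ∧ H (m + 1) = 0 from h.1
  induction m using Int.induction_on with
  | zero => exact ⟨h0, by simpa using h1⟩
  | succ i ih =>
    refine ⟨ih.2, ?_⟩
    have h := hH (i + 1 + 1)
    rw [show (i + 1 + 1 - 1 : ℤ) = i + 1 by ring, show (i + 1 + 1 - 2 : ℤ) = i by ring] at h
    rw [h, ih.1, ih.2, add_zero]
  | pred i ih =>
    have h := hH (-i + 1)
    rw [show (-i + 1 - 1 : ℤ) = -i by ring, show (-i + 1 - 2 : ℤ) = -i - 1 by ring,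
      ih.1, ih.2] at h
    refine ⟨by linarith, ?_⟩
    rw [sub_add_cancel]
    exact ih.1

/-- Two-sided sequences satisfying the Fibonacci recurrence are determined by their values at
`0` and `1`. -/
theorem fibonacci_recurrence_ext {H K : ℤ → ℝ} (hH : ∀ m : ℤ, H m = H (m - 1) + H (m - 2))
    (hK : ∀ m : ℤ, K m = K (m - 1) + K (m - 2)) (h0 : H 0 = K 0) (h1 : H 1 = K 1) (m : ℤ) :
    H m = K m := by
  refine sub_eq_zero.1 (fibonacci_recurrence_eq_zero (H := fun m ↦ H m - K m)
    (fun m ↦ ?_) (sub_eq_zero.2 h0) (sub_eq_zero.2 h1) m)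
  linarith [hH m, hK m]

theorem fibonacci_eq_intFib {F : ℤ → ℝ} (hF0 : F 0 = 0) (hF1 : F 1 = 1)
    (hF : ∀ m : ℤ, F m = F (m - 1) + F (m - 2)) (m : ℤ) : F m = Int.fib m := by
  refine fibonacci_recurrence_ext (K := fun m ↦ (Int.fib m : ℝ)) hF (fun m ↦ ?_)
    (by simp [hF0]) (by simp [hF1]) m
  have h := Int.fib_add_two (m - 2)
  rw [show m - 2 + 2 = m by ring, show m - 2 + 1 = m - 1 by ring] at h
  rw [h, Int.cast_add, add_comm]

theorem neg_one_zpow_mul_sub {F G : ℤ → ℝ} (hF0 : F 0 = 0) (hF1 : F 1 = 1)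
    (hF : ∀ m : ℤ, F m = F (m - 1) + F (m - 2)) (hG : ∀ m : ℤ, G m = G (m - 1) + G (m - 2))
    (p r : ℤ) :
    (-1 : ℝ) ^ r * G (p - r) = F (r + 1) * G p - F r * G (p + 1) := by
  have hF2 : F 2 = 1 := by simpa [hF0, hF1] using hF 2
  refine fibonacci_recurrence_ext (H := fun r ↦ (-1 : ℝ) ^ r * G (p - r))
    (K := fun r ↦ F (r + 1) * G p - F r * G (p + 1)) (fun r ↦ ?_) (fun r ↦ ?_) ?_ ?_ r
  · have h := hG (p - r + 2)
    have e : (-1 : ℝ) ^ (r - 1) = -(-1 : ℝ) ^ r := by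
      rw [zpow_sub_one₀ (by norm_num)]; norm_num
    have e' : (-1 : ℝ) ^ (r - 2) = (-1 : ℝ) ^ r := by
      rw [zpow_sub₀ (by norm_num)]; norm_num
    rw [e, e', show p - (r - 1) = p - r + 2 - 1 by ring, show p - (r - 2) = p - r + 2 by ring, h,
      show p - r + 2 - 2 = p - r by ring]
    ring
  · have h := hF (r + 1)
    rw [show r + 1 - 1 = r - 1 + 1 by ring, show r + 1 - 2 = r - 2 + 1 by ring] at h
    rw [h, hF r]
    ring
  · simp [hF0, hF1]
  · have h := hG (p + 1)
    rw [show p + 1 - 1 = p by ring, show p + 1 - 2 = p - 1 by ring] at h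
    norm_num [hF1, hF2]
    linarith

theorem fibonacci_mul_sub {F G : ℤ → ℝ} (hF0 : F 0 = 0) (hF1 : F 1 = 1)
    (hF : ∀ m : ℤ, F m = F (m - 1) + F (m - 2)) (hG : ∀ m : ℤ, G m = G (m - 1) + G (m - 2))
    (p n r : ℤ) :
    F n * ((-1 : ℝ) ^ r * G (p - r)) = F (n + r) * G p - F r * G (p + n) := by
  refine fibonacci_recurrence_ext (H := fun n ↦ F n * ((-1 : ℝ) ^ r * G (p - r)))
    (K := fun n ↦ F (n + r) * G p - F r * G (p + n)) (fun n ↦ ?_) (fun n ↦ ?_) ?_ ?_ n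
  · rw [hF n]
    ring
  · have h := hF (n + r)
    have h' := hG (p + n)
    rw [h, h', show n + r - 1 = n - 1 + r by ring, show n + r - 2 = n - 2 + r by ring,
      show p + n - 1 = p + (n - 1) by ring, show p + n - 2 = p + (n - 2) by ring]
    ring
  · simp [hF0]
  · rw [hF1, one_mul, neg_one_zpow_mul_sub hF0 hF1 hF hG, add_comm 1 r]

/-- If a sequence is an eigenvector of the operator `E⁻ᵃ (1 + x Eʳ)`, where `E` is the shift, the
binomial expansion of the `k`-th power of this operator acts on it by the `k`-th power of the
eigenvalue. -/
theorem sum_choose_mul_shift {G : ℤ → ℝ} {a r : ℤ} {x y : ℝ}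
    (h : ∀ m : ℤ, G (m - a) + x * G (m - a + r) = y * G m) (k : ℕ) (m : ℤ) :
    ∑ j ∈ Finset.range (k + 1), (k.choose j : ℝ) * (x ^ j * G (m - a * k + r * j))
      = y ^ k * G m := by
  induction k generalizing m with
  | zero => simp
  | succ k ih =>
    rw [Finset.sum_choose_succ_mul (fun j _ ↦ x ^ j * G (m - a * (k + 1 : ℕ) + r * j)) k,
      pow_succ, mul_assoc, ← h m, mul_add, mul_left_comm, ← ih (m - a), ← ih (m - a + r),
      Finset.mul_sum]
    congr 1 <;> refine Finset.sum_congr rfl fun j _ ↦ ?_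
    · congr 3
      push_cast
      ring
    · rw [pow_succ', mul_assoc, mul_left_comm]
      congr 4
      push_cast
      ring

/-- Weighted binomial sum identity for generalized Fibonacci sequences
(Adegoke, Theorem 5, identity (17)). -/
theorem stmt_5 (F G : ℤ → ℝ)
    (hF0 : F 0 = 0) (hF1 : F 1 = 1)
    (hF : ∀ m : ℤ, F m = F (m - 1) + F (m - 2))
    (hG : ∀ m : ℤ, G m = G (m - 1) + G (m - 2))
    (m n r : ℤ) (hn : n ≠ 0) (k : ℕ) :
    ∑ j ∈ Finset.range (k + 1),
        (-1 : ℝ) ^ j * (-1 : ℝ) ^ (r * (j : ℤ)) * (Nat.choose k j : ℝ)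
          * (F (n + r) / F n) ^ j * G (m - (n + r) * k + r * j)
      = (-1 : ℝ) ^ k * (-1 : ℝ) ^ (r * (k : ℤ)) * (F r / F n) ^ k * G m := by
  have hFn : F n ≠ 0 := by
    rw [fibonacci_eq_intFib hF0 hF1 hF]
    exact_mod_cast Int.fib_eq_zero.not.2 hn
  have hs : (-1 : ℝ) ^ r * (-1 : ℝ) ^ r = 1 := by
    rw [← mul_zpow]; norm_num
  have h (m : ℤ) : G (m - (n + r)) + -1 * (-1) ^ r * (F (n + r) / F n) * G (m - (n + r) + r)
      = -1 * (-1) ^ r * (F r / F n) * G m := by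
    have h' := fibonacci_mul_sub hF0 hF1 hF hG (m - n) n r
    rw [sub_add_cancel, sub_sub] at h'
    rw [show m - (n + r) + r = m - n by ring]
    field_simp
    linear_combination (-1 : ℝ) ^ r * h' - F n * G (m - (n + r)) * hs
  have key := sum_choose_mul_shift h k m
  simp only [mul_pow, ← zpow_natCast ((-1 : ℝ) ^ r), ← zpow_mul] at key
  rw [← key]
  exact Finset.sum_congr rfl fun j _ ↦ by ring
end

section
/- For all integers m, n and every nonnegative integer k: ∑_{j=0}^{k} ∑_{s=0}^{k−j} (-1)^{n·(j+s)} · C(k,j) · C(k−j,s) · F(n)^{j+s} · G(m−2n·k+(n+1)·j+(n−1)·s) = (-1)^{n·k} · G(m), where C(k,j) denotes the binomial coefficient. -/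
/-- A sequence on `ℤ` satisfying the Fibonacci recurrence is determined by its values at
`0` and `1`. -/
theorem fib_recurrence_unique {a b : ℤ → ℝ}
    (ha : ∀ m : ℤ, a m = a (m - 1) + a (m - 2))
    (hb : ∀ m : ℤ, b m = b (m - 1) + b (m - 2))
    (h0 : a 0 = b 0) (h1 : a 1 = b 1) (m : ℤ) : a m = b m := by
  suffices h : a m = b m ∧ a (m + 1) = b (m + 1) from h.1
  induction m using Int.induction_on with
  | zero => exact ⟨h0, by simpa using h1⟩
  | succ i ih =>
    have h2 := ha (i + 1 + 1)
    have h3 := hb (i + 1 + 1)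
    rw [show (i + 1 + 1 - 1 : ℤ) = i + 1 by ring, show (i + 1 + 1 - 2 : ℤ) = i by ring] at h2 h3
    exact ⟨ih.2, by rw [h2, h3, ih.1, ih.2]⟩
  | pred i ih =>
    have h2 := ha (-i + 1)
    have h3 := hb (-i + 1)
    rw [show (-i + 1 - 1 : ℤ) = -i by ring, show (-i + 1 - 2 : ℤ) = -i - 1 by ring] at h2 h3
    rw [show (-i - 1 + 1 : ℤ) = -i by ring]
    exact ⟨by linarith [ih.1, ih.2], ih.1⟩

/-- Powers of a root of `x ^ 2 = x + 1` satisfy the Fibonacci recurrence. -/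
theorem zpow_fib_recurrence {x : ℝ} (hx : x ^ 2 = x + 1) (m : ℤ) :
    x ^ m = x ^ (m - 1) + x ^ (m - 2) := by
  have hx0 : x ≠ 0 := by rintro rfl; norm_num at hx
  have h1 : x ^ m = x ^ (m - 2) * x ^ 2 := by
    rw [← zpow_natCast, ← zpow_add₀ hx0]; congr 1; push_cast; ring
  have h2 : x ^ (m - 1) = x ^ (m - 2) * x := by
    rw [← zpow_add_one₀ hx0]; congr 1; ring
  rw [h1, h2, hx]; ring

/-- Binet's formula for generalized Fibonacci sequences. -/
theorem exists_binet {G : ℤ → ℝ} (hG : ∀ m : ℤ, G m = G (m - 1) + G (m - 2)) :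
    ∃ A B : ℝ, ∀ m : ℤ, G m = A * Real.goldenRatio ^ m + B * Real.goldenConj ^ m := by
  have hne : Real.goldenRatio - Real.goldenConj ≠ 0 := by
    rw [Real.goldenRatio_sub_goldenConj]; positivity
  refine ⟨(G 1 - G 0 * Real.goldenConj) / (Real.goldenRatio - Real.goldenConj),
    (G 0 * Real.goldenRatio - G 1) / (Real.goldenRatio - Real.goldenConj), fun m => ?_⟩
  refine fib_recurrence_unique (b := fun m =>
    (G 1 - G 0 * Real.goldenConj) / (Real.goldenRatio - Real.goldenConj) * Real.goldenRatio ^ m +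
      (G 0 * Real.goldenRatio - G 1) / (Real.goldenRatio - Real.goldenConj) * Real.goldenConj ^ m)
    hG (fun i => ?_) ?_ ?_ m
  · rw [zpow_fib_recurrence Real.goldenRatio_sq i, zpow_fib_recurrence Real.goldenConj_sq i]
    ring
  · simp only [zpow_zero]; field_simp; ring
  · simp only [zpow_one]; field_simp; ring

/-- Binet's formula for the Fibonacci sequence, in terms of a single root of `x ^ 2 = x + 1`. -/
theorem fib_mul_add_inv {F : ℤ → ℝ} (hF0 : F 0 = 0) (hF1 : F 1 = 1)
    (hF : ∀ m : ℤ, F m = F (m - 1) + F (m - 2)) {x : ℝ} (hx : x ^ 2 = x + 1) (n : ℤ) :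
    F n * (x + x⁻¹) = x ^ n - (-1) ^ n * (x ^ n)⁻¹ := by
  have hx0 : x ≠ 0 := by rintro rfl; norm_num at hx
  have hinv : x⁻¹ = x - 1 := by
    field_simp; linarith
  have hy : (-x⁻¹) ^ 2 = -x⁻¹ + 1 := by rw [hinv]; linarith
  have key := fib_recurrence_unique (a := fun n => F n * (x + x⁻¹))
    (b := fun n => x ^ n - (-x⁻¹) ^ n) (fun i => by rw [hF i]; ring)
    (fun i => by
      rw [zpow_fib_recurrence hx i, zpow_fib_recurrence hy i]; ring)
    (by simp [hF0]) (by simp [hF1]) n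
  rw [key, ← inv_zpow, ← mul_zpow, neg_one_mul]

/-- A double binomial sum as the power of a trinomial. -/
theorem sum_choose_mul_choose_mul_pow (a b : ℝ) (k : ℕ) :
    ∑ j ∈ Finset.range (k + 1), ∑ s ∈ Finset.range (k - j + 1),
      (Nat.choose k j : ℝ) * (Nat.choose (k - j) s : ℝ) * a ^ j * b ^ s = (a + b + 1) ^ k := by
  rw [add_assoc, add_pow]
  refine Finset.sum_congr rfl fun j _ => ?_
  rw [add_pow, Finset.mul_sum, Finset.sum_mul]
  refine Finset.sum_congr rfl fun s _ => ?_
  rw [one_pow]; ring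

/-- The double binomial sum identity for the powers of a root of `x ^ 2 = x + 1`. -/
theorem sum_choose_fib_zpow {F : ℤ → ℝ} (hF0 : F 0 = 0) (hF1 : F 1 = 1)
    (hF : ∀ m : ℤ, F m = F (m - 1) + F (m - 2)) {x : ℝ} (hx : x ^ 2 = x + 1)
    (m n : ℤ) (k : ℕ) :
    ∑ j ∈ Finset.range (k + 1), ∑ s ∈ Finset.range (k - j + 1),
        (-1 : ℝ) ^ (n * ((j : ℤ) + s)) * (Nat.choose k j : ℝ)
          * (Nat.choose (k - j) s : ℝ) * F n ^ (j + s)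
          * x ^ (m - 2 * n * k + (n + 1) * j + (n - 1) * s)
      = (-1 : ℝ) ^ (n * (k : ℤ)) * x ^ m := by
  have hx0 : x ≠ 0 := by rintro rfl; norm_num at hx
  have hsq : ((-1 : ℝ) ^ n) * (-1) ^ n = 1 := by
    rw [← mul_zpow]; norm_num
  have hbase : (-1 : ℝ) ^ n * F n * x ^ (n + 1) + (-1) ^ n * F n * x ^ (n - 1) + 1
      = (-1) ^ n * (x ^ n * x ^ n) := by
    have hxn : x ^ n ≠ 0 := zpow_ne_zero n hx0
    have hB := fib_mul_add_inv hF0 hF1 hF hx n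
    rw [zpow_add_one₀ hx0, zpow_sub_one₀ hx0]
    calc _ = (-1) ^ n * x ^ n * (F n * (x + x⁻¹)) + 1 := by ring
      _ = (-1) ^ n * (x ^ n * x ^ n) - ((-1) ^ n * (-1) ^ n) * (x ^ n * (x ^ n)⁻¹) + 1 := by
        rw [hB]; ring
      _ = _ := by rw [hsq, mul_inv_cancel₀ hxn]; ring
  have hfactor : ∀ j s : ℕ, (-1 : ℝ) ^ (n * ((j : ℤ) + s)) * (Nat.choose k j : ℝ)
          * (Nat.choose (k - j) s : ℝ) * F n ^ (j + s)
          * x ^ (m - 2 * n * k + (n + 1) * j + (n - 1) * s)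
      = x ^ (m - 2 * n * k) * ((Nat.choose k j : ℝ) * (Nat.choose (k - j) s : ℝ)
          * ((-1) ^ n * F n * x ^ (n + 1)) ^ j * ((-1) ^ n * F n * x ^ (n - 1)) ^ s) := by
    intro j s
    rw [zpow_add₀ hx0, zpow_add₀ hx0 (m - 2 * n * k), zpow_mul x (n + 1), zpow_mul x (n - 1),
      zpow_mul (-1 : ℝ), ← Nat.cast_add]
    simp only [zpow_natCast]
    ring
  simp only [hfactor, ← Finset.mul_sum]
  rw [sum_choose_mul_choose_mul_pow, hbase, mul_pow, ← zpow_add₀ hx0, ← zpow_natCast,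
    ← zpow_natCast, ← zpow_mul, ← zpow_mul, mul_left_comm, ← zpow_add₀ hx0]
  congr 2
  ring


/-- Weighted double binomial sum identity for generalized Fibonacci sequences. -/
theorem stmt_6 (F G : ℤ → ℝ)
    (hF0 : F 0 = 0) (hF1 : F 1 = 1)
    (hF : ∀ m : ℤ, F m = F (m - 1) + F (m - 2))
    (hG : ∀ m : ℤ, G m = G (m - 1) + G (m - 2))
    (m n : ℤ) (k : ℕ) :
    ∑ j ∈ Finset.range (k + 1), ∑ s ∈ Finset.range (k - j + 1),
        (-1 : ℝ) ^ (n * ((j : ℤ) + s)) * (Nat.choose k j : ℝ)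
          * (Nat.choose (k - j) s : ℝ) * F n ^ (j + s)
          * G (m - 2 * n * k + (n + 1) * j + (n - 1) * s)
      = (-1 : ℝ) ^ (n * (k : ℤ)) * G m := by
  obtain ⟨A, B, hAB⟩ := exists_binet hG
  have hφ := sum_choose_fib_zpow hF0 hF1 hF Real.goldenRatio_sq m n k
  have hψ := sum_choose_fib_zpow hF0 hF1 hF Real.goldenConj_sq m n k
  rw [hAB m, mul_add, mul_left_comm, mul_left_comm _ B, ← hφ, ← hψ]
  simp only [Finset.mul_sum, ← Finset.sum_add_distrib]
  refine Finset.sum_congr rfl fun j _ => Finset.sum_congr rfl fun s _ => ?_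
  rw [hAB]
  ring
end

section
/- For all integers m, n with n ≠ 0 (so that F(n) ≠ 0) and every nonnegative integer k: ∑_{j=0}^{k} ∑_{s=0}^{j} (-1)^s · C(k,j) · C(j,s) · G(m+(n+1)·k−2j+(n+1)·s) / F(n)^s = (-1)^{(n+1)·k} · G(m) / F(n)^k, where C(k,j) denotes the binomial coefficient. -/
/-- A sequence on `ℤ` satisfying the Fibonacci recurrence is determined by its values at `0`
and `1`. -/
theorem fibonacciRec_ext {G H : ℤ → ℝ}
    (hG : ∀ m : ℤ, G m = G (m - 1) + G (m - 2))
    (hH : ∀ m : ℤ, H m = H (m - 1) + H (m - 2))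
    (h0 : G 0 = H 0) (h1 : G 1 = H 1) (m : ℤ) : G m = H m := by
  suffices h : G m = H m ∧ G (m + 1) = H (m + 1) from h.1
  induction m using Int.induction_on with
  | zero => exact ⟨h0, by simpa using h1⟩
  | succ i ih =>
    refine ⟨ih.2, ?_⟩
    have hg := hG (i + 1 + 1)
    have hh := hH (i + 1 + 1)
    rw [show (i + 1 + 1 - 1 : ℤ) = i + 1 by ring, show (i + 1 + 1 - 2 : ℤ) = i by ring] at hg hh
    rw [hg, hh, ih.1, ih.2]
  | pred i ih =>
    have hg := hG (-i + 1)
    have hh := hH (-i + 1)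
    rw [show (-i + 1 - 1 : ℤ) = -i by ring, show (-i + 1 - 2 : ℤ) = -i - 1 by ring] at hg hh
    rw [show (-i - 1 + 1 : ℤ) = -i by ring]
    exact ⟨by linarith [ih.1, ih.2], ih.1⟩

/-- Powers of a root of `x ^ 2 = x + 1` satisfy the Fibonacci recurrence. -/
theorem zpow_fibonacciRec {c : ℝ} (hc0 : c ≠ 0) (hc : c ^ 2 = c + 1) (m : ℤ) :
    c ^ m = c ^ (m - 1) + c ^ (m - 2) := by
  have h1 : c ^ m = c ^ (m - 2) * c ^ 2 := by
    rw [← zpow_natCast c 2, ← zpow_add₀ hc0]; congr 1; push_cast; ring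
  have h2 : c ^ (m - 1) = c ^ (m - 2) * c := by
    rw [← zpow_add_one₀ hc0]; congr 1; ring
  rw [h1, h2, hc]; ring

/-- Binet's formula for generalized Fibonacci sequences on `ℤ`. -/
theorem fibonacciRec_binet {G : ℤ → ℝ} (hG : ∀ m : ℤ, G m = G (m - 1) + G (m - 2)) (m : ℤ) :
    G m = (G 1 - G 0 * Real.goldenConj) / √5 * Real.goldenRatio ^ m
      + (G 0 * Real.goldenRatio - G 1) / √5 * Real.goldenConj ^ m := by
  have h5 : √5 ≠ 0 := by positivity
  have hd := Real.goldenRatio_sub_goldenConj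
  refine fibonacciRec_ext (H := fun m => (G 1 - G 0 * Real.goldenConj) / √5 * Real.goldenRatio ^ m
      + (G 0 * Real.goldenRatio - G 1) / √5 * Real.goldenConj ^ m) hG (fun m => ?_) ?_ ?_ m
  · rw [zpow_fibonacciRec Real.goldenRatio_ne_zero Real.goldenRatio_sq m,
      zpow_fibonacciRec Real.goldenConj_ne_zero Real.goldenConj_sq m]
    ring
  · simp only [zpow_zero]
    field_simp
    linear_combination -G 0 * hd
  · simp only [zpow_one]
    field_simp
    linear_combination -G 1 * hd

/-- The double binomial sum of powers of `c` factors as a `k`-th power. -/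
theorem sum_sum_choose_zpow {c : ℝ} (hc0 : c ≠ 0) (f : ℝ) (m n : ℤ) (k : ℕ) :
    ∑ j ∈ Finset.range (k + 1), ∑ s ∈ Finset.range (j + 1),
        (-1 : ℝ) ^ s * (Nat.choose k j : ℝ) * (Nat.choose j s : ℝ)
          * c ^ (m + (n + 1) * k - 2 * j + (n + 1) * s) / f ^ s
      = c ^ m * (c ^ (n + 1) + c ^ (n - 1) - c ^ (2 * n) / f) ^ k := by
  have hbase : c ^ (n + 1) + c ^ (n - 1) - c ^ (2 * n) / f
      = c ^ (n + 1) * (c ^ (-2 : ℤ) * (-(c ^ (n + 1) / f) + 1) + 1) := by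
    have h1 : c ^ (n - 1) = c ^ (n + 1) * c ^ (-2 : ℤ) := by
      rw [← zpow_add₀ hc0]; congr 1; ring
    have h2 : c ^ (2 * n) = c ^ (n + 1) * c ^ (-2 : ℤ) * c ^ (n + 1) := by
      rw [← zpow_add₀ hc0, ← zpow_add₀ hc0]; congr 1; ring
    rw [h1, h2]; ring
  rw [hbase, mul_pow, add_pow, Finset.mul_sum, Finset.mul_sum]
  refine Finset.sum_congr rfl fun j _ => ?_
  rw [mul_pow, add_pow, Finset.mul_sum, Finset.sum_mul, Finset.sum_mul, Finset.mul_sum,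
    Finset.mul_sum]
  refine Finset.sum_congr rfl fun s _ => ?_
  have he : c ^ (m + (n + 1) * k - 2 * j + (n + 1) * s)
      = c ^ m * (c ^ (n + 1)) ^ k * (c ^ (-2 : ℤ)) ^ j * (c ^ (n + 1)) ^ s := by
    simp only [← zpow_natCast, ← zpow_mul, ← zpow_add₀ hc0]
    ring_nf
  rw [he, neg_pow (_ / _), div_pow]
  simp only [one_pow]
  ring

/-- If `c * d = -1` and `f = (c ^ n - d ^ n) / (c - d)`, then the base of the power in
`sum_sum_choose_zpow` is `(-1) ^ (n + 1) / f`. -/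
theorem zpow_add_zpow_sub_div {c d f : ℝ} (hcd : c * d = -1) {n : ℤ} (hf0 : f ≠ 0)
    (hf : f * (c - d) = c ^ n - d ^ n) :
    c ^ (n + 1) + c ^ (n - 1) - c ^ (2 * n) / f = (-1) ^ (n + 1) / f := by
  have hc0 : c ≠ 0 := by rintro rfl; norm_num at hcd
  have hp : c ^ n * d ^ n = (-1) ^ n := by rw [← mul_zpow, hcd]
  have hinv : c⁻¹ = -d := inv_eq_of_mul_eq_one_right (by rw [mul_neg, hcd, neg_neg])
  rw [zpow_add_one₀ hc0, zpow_sub_one₀ hc0, hinv, zpow_add_one₀ (by norm_num), two_mul,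
    zpow_add₀ hc0, ← hp]
  field_simp
  linear_combination hf


/-- Weighted double binomial sum identity for generalized Fibonacci sequences. -/
theorem stmt_9 (F G : ℤ → ℝ)
    (hF0 : F 0 = 0) (hF1 : F 1 = 1)
    (hF : ∀ m : ℤ, F m = F (m - 1) + F (m - 2))
    (hG : ∀ m : ℤ, G m = G (m - 1) + G (m - 2))
    (m n : ℤ) (hn : n ≠ 0) (k : ℕ) :
    ∑ j ∈ Finset.range (k + 1), ∑ s ∈ Finset.range (j + 1),
        (-1 : ℝ) ^ s * (Nat.choose k j : ℝ) * (Nat.choose j s : ℝ)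
          * G (m + (n + 1) * k - 2 * j + (n + 1) * s) / F n ^ s
      = (-1 : ℝ) ^ ((n + 1) * (k : ℤ)) * G m / F n ^ k := by
  have hfib : F n = Int.fib n := by
    refine fibonacciRec_ext (H := fun m => (Int.fib m : ℝ)) hF (fun m => ?_)
      (by simp [hF0]) (by simp [hF1]) n
    have h := Int.fib_add_two (m - 2)
    rw [show m - 2 + 2 = m by ring, show m - 2 + 1 = m - 1 by ring] at h
    rw [h]
    push_cast
    ring
  have hFn0 : F n ≠ 0 := by simpa [hfib] using hn
  have hFn : F n * (Real.goldenRatio - Real.goldenConj)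
      = Real.goldenRatio ^ n - Real.goldenConj ^ n := by
    rw [hfib, Real.coe_intFib_eq, Real.goldenRatio_sub_goldenConj]
    exact div_mul_cancel₀ _ (by positivity)
  have hφ := zpow_add_zpow_sub_div Real.goldenRatio_mul_goldenConj hFn0 hFn
  have hψ := zpow_add_zpow_sub_div Real.goldenConj_mul_goldenRatio hFn0
    (by linear_combination -hFn : F n * (Real.goldenConj - Real.goldenRatio)
      = Real.goldenConj ^ n - Real.goldenRatio ^ n)
  have sφ := sum_sum_choose_zpow Real.goldenRatio_ne_zero (F n) m n k
  have sψ := sum_sum_choose_zpow Real.goldenConj_ne_zero (F n) m n k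
  rw [hφ] at sφ
  rw [hψ] at sψ
  have hb := fibonacciRec_binet hG
  generalize (G 1 - G 0 * Real.goldenConj) / √5 = A at hb
  generalize (G 0 * Real.goldenRatio - G 1) / √5 = B at hb
  trans A * (Real.goldenRatio ^ m * ((-1) ^ (n + 1) / F n) ^ k)
      + B * (Real.goldenConj ^ m * ((-1) ^ (n + 1) / F n) ^ k)
  · rw [← sφ, ← sψ]
    simp only [Finset.mul_sum, ← Finset.sum_add_distrib]
    refine Finset.sum_congr rfl fun j _ => Finset.sum_congr rfl fun s _ => ?_
    rw [hb]
    ring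
  · rw [hb m, zpow_mul, zpow_natCast, div_pow]
    ring
end

section
/- Let G and H be generalized Fibonacci sequences. For all integers m, n, r with G(0) ≠ 0 and every nonnegative integer k: ∑_{j=0}^{k} ∑_{s=0}^{j} (-1)^{n·j+s} · C(k,j) · C(j,s) · (G(n+r)^{j−s} · G(n)^s / G(0)^j) · H(m+r·k+(n−r)·j+r·s) = (G(r)/G(0))^k · H(m), where C(k,j) denotes the binomial coefficient. -/
/-- Binet's formula for a two-sided sequence satisfying the Fibonacci recurrence. -/
lemma exists_eq_goldenRatio_zpow (G : ℤ → ℝ) (hG : ∀ m : ℤ, G m = G (m - 1) + G (m - 2)) :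
    ∃ a b : ℝ, ∀ m : ℤ, G m = a * Real.goldenRatio ^ m + b * Real.goldenConj ^ m := by
  have hd : Real.goldenRatio - Real.goldenConj ≠ 0 := by
    rw [Real.goldenRatio_sub_goldenConj]; positivity
  have hx := Real.goldenRatio_ne_zero
  have hy := Real.goldenConj_ne_zero
  have hx2 := Real.goldenRatio_sq
  have hy2 := Real.goldenConj_sq
  generalize Real.goldenRatio = x at *
  generalize Real.goldenConj = y at *
  refine ⟨(G 1 - y * G 0) / (x - y), (x * G 0 - G 1) / (x - y), ?_⟩
  set a := (G 1 - y * G 0) / (x - y) with ha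
  set b := (x * G 0 - G 1) / (x - y) with hb
  have step (z : ℝ) (hz : z ≠ 0) (hz2 : z ^ 2 = z + 1) (i : ℤ) :
      z ^ (i + 1 + 1) = z ^ (i + 1) + z ^ i := by
    rw [zpow_add_one₀ hz, zpow_add_one₀ hz]
    linear_combination z ^ i * hz2
  have pair (i : ℤ) : G i = a * x ^ i + b * y ^ i ∧
      G (i + 1) = a * x ^ (i + 1) + b * y ^ (i + 1) := by
    induction i using Int.induction_on with
    | zero =>
      constructor
      · simp only [zpow_zero, ha, hb]; field_simp; ring
      · simp only [zero_add, zpow_one, ha, hb]; field_simp; ring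
    | succ i ih =>
      refine ⟨ih.2, ?_⟩
      have h := hG ((i : ℤ) + 1 + 1)
      rw [show (i : ℤ) + 1 + 1 - 1 = i + 1 by ring, show (i : ℤ) + 1 + 1 - 2 = i by ring] at h
      rw [h, ih.1, ih.2, step x hx hx2, step y hy hy2]
      ring
    | pred i ih =>
      obtain ⟨j, hj⟩ : ∃ j : ℤ, -(i : ℤ) = j + 1 := ⟨-(i : ℤ) - 1, by ring⟩
      rw [hj] at ih ⊢
      rw [add_sub_cancel_right]
      refine ⟨?_, ih.1⟩
      have h := hG (j + 1 + 1)
      rw [show j + 1 + 1 - 1 = j + 1 by ring, show j + 1 + 1 - 2 = j by ring] at h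
      have h2 := ih.2
      rw [step x hx hx2, step y hy hy2] at h2
      linear_combination h2 - ih.1 - h
  exact fun m => (pair m).1

/-- The double binomial sum for the geometric sequence `x ^ m`, where `x` is one of the two
characteristic roots of the recurrence. -/
lemma sum_sum_choose_mul_zpow (G : ℤ → ℝ) {x y a b : ℝ} (hxy : x * y = -1)
    (hG : ∀ m : ℤ, G m = a * x ^ m + b * y ^ m) (m n r : ℤ) (hG0 : G 0 ≠ 0) (k : ℕ) :
    ∑ j ∈ Finset.range (k + 1), ∑ s ∈ Finset.range (j + 1),
        (-1 : ℝ) ^ (n * (j : ℤ) + s) * (Nat.choose k j : ℝ) * (Nat.choose j s : ℝ)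
          * (G (n + r) ^ (j - s) * G n ^ s / G 0 ^ j)
          * x ^ (m + r * k + (n - r) * j + r * s)
      = (G r / G 0) ^ k * x ^ m := by
  have hx : x ≠ 0 := by rintro rfl; simp at hxy
  have hy : y ≠ 0 := by rintro rfl; simp at hxy
  have key : G r / G 0 =
      (-1) ^ n * x ^ n / G 0 * (-(G n * x ^ r) + G (n + r)) + x ^ r := by
    have h1 : (-1 : ℝ) ^ n * x ^ n * y ^ n = 1 := by
      rw [mul_assoc, ← mul_zpow, hxy, ← mul_zpow]; norm_num
    have h0 : G 0 = a + b := by simpa using hG 0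
    rw [div_mul_eq_mul_div, div_add' _ _ _ hG0, h0, hG r, hG n, hG (n + r),
      zpow_add₀ hx, zpow_add₀ hy]
    congr 1
    linear_combination (b * x ^ r - b * y ^ r) * h1
  rw [key, add_pow, Finset.sum_mul]
  refine Finset.sum_congr rfl fun j hj => ?_
  have hjk : j ≤ k := by simpa [Nat.lt_succ_iff] using hj
  rw [mul_pow, add_pow, Finset.mul_sum, Finset.sum_mul, Finset.sum_mul, Finset.sum_mul]
  refine Finset.sum_congr rfl fun s _ => ?_
  obtain ⟨l, rfl⟩ := Nat.exists_eq_add_of_le hjk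
  have e1 : (-1 : ℝ) ^ (n * (j : ℤ) + s) = ((-1) ^ n) ^ j * (-1) ^ s := by
    rw [zpow_add₀ (by norm_num), zpow_mul, zpow_natCast, zpow_natCast]
  have e2 : x ^ (m + r * ((j + l : ℕ) : ℤ) + (n - r) * j + r * s) =
      x ^ m * (x ^ r) ^ l * (x ^ n) ^ j * (x ^ r) ^ s := by
    simp only [← zpow_natCast, ← zpow_mul, ← zpow_add₀ hx]
    congr 1
    push_cast
    ring
  rw [e1, e2, Nat.add_sub_cancel_left, neg_pow (G n * x ^ r), div_pow, mul_pow, mul_pow]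
  ring

/-- Weighted double binomial sum identity for two generalized Fibonacci sequences. -/
theorem stmt_12 (G H : ℤ → ℝ)
    (hG : ∀ m : ℤ, G m = G (m - 1) + G (m - 2))
    (hH : ∀ m : ℤ, H m = H (m - 1) + H (m - 2))
    (m n r : ℤ) (hG0 : G 0 ≠ 0) (k : ℕ) :
    ∑ j ∈ Finset.range (k + 1), ∑ s ∈ Finset.range (j + 1),
        (-1 : ℝ) ^ (n * (j : ℤ) + s) * (Nat.choose k j : ℝ) * (Nat.choose j s : ℝ)
          * (G (n + r) ^ (j - s) * G n ^ s / G 0 ^ j)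
          * H (m + r * k + (n - r) * j + r * s)
      = (G r / G 0) ^ k * H m := by
  obtain ⟨a, b, hab⟩ := exists_eq_goldenRatio_zpow G hG
  obtain ⟨c, d, hcd⟩ := exists_eq_goldenRatio_zpow H hH
  have h1 := sum_sum_choose_mul_zpow G Real.goldenRatio_mul_goldenConj hab m n r hG0 k
  have h2 := sum_sum_choose_mul_zpow G Real.goldenConj_mul_goldenRatio
    (fun i => (hab i).trans (add_comm _ _)) m n r hG0 k
  rw [hcd m, mul_add, mul_left_comm, ← h1, mul_left_comm, ← h2]
  simp only [Finset.mul_sum, ← Finset.sum_add_distrib]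
  refine Finset.sum_congr rfl fun j _ => Finset.sum_congr rfl fun s _ => ?_
  rw [hcd]
  ring
end

section
/- Let G and H be generalized Fibonacci sequences. For all integers m, n, r with G(n) ≠ 0 and every nonnegative integer k: ∑_{j=0}^{k} ∑_{s=0}^{j} (-1)^{n·(j+s)+j} · C(k,j) · C(j,s) · (G(0)^{j−s} · G(n+r)^s / G(n)^j) · H(m+(n+r)·k−n·j+(n−r)·s) = (-1)^{(n+1)·k} · (G(r)/G(n))^k · H(m), where C(k,j) denotes the binomial coefficient. -/
/-- The translation operator `F ↦ (x ↦ F (x + a))` on real functions on `ℤ`. -/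
def shiftEnd (a : ℤ) : Module.End ℝ (ℤ → ℝ) where
  toFun F := fun x => F (x + a)
  map_add' _ _ := rfl
  map_smul' _ _ := rfl

theorem shiftEnd_apply (a : ℤ) (F : ℤ → ℝ) (x : ℤ) : shiftEnd a F x = F (x + a) := rfl

theorem shiftEnd_mul (a b : ℤ) : shiftEnd a * shiftEnd b = shiftEnd (a + b) := by
  ext F x
  simp [shiftEnd_apply, Module.End.mul_apply, add_assoc]

theorem shiftEnd_commute (a b : ℤ) : Commute (shiftEnd a) (shiftEnd b) := by
  rw [Commute, SemiconjBy, shiftEnd_mul, shiftEnd_mul, add_comm]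

theorem shiftEnd_pow (a : ℤ) (k : ℕ) : shiftEnd a ^ k = shiftEnd (a * k) := by
  induction k with
  | zero =>
    ext F x
    simp [shiftEnd_apply]
  | succ k ih =>
    rw [pow_succ, ih, shiftEnd_mul]
    push_cast
    ring_nf

/-- Vajda-type identity for two generalized Fibonacci sequences. -/
theorem fib_cross_identity (G H : ℤ → ℝ)
    (hG : ∀ m : ℤ, G m = G (m - 1) + G (m - 2))
    (hH : ∀ m : ℤ, H m = H (m - 1) + H (m - 2)) (m n r : ℤ) :
    G n * H (m + n + r) - G (n + r) * H (m + n)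
      = (-1 : ℝ) ^ n * (G 0 * H (m + r) - G r * H m) := by
  have hGr (x : ℤ) : G (x + 2) = G (x + 1) + G x := by
    rw [hG (x + 2)]; congr 2 <;> ring
  have hHr (x : ℤ) : H (x + 2) = H (x + 1) + H x := by
    rw [hH (x + 2)]; congr 2 <;> ring
  -- Both sides change sign under `n ↦ n + 1`, which is proved for all `r` from `r = 0, 1`.
  have step (n : ℤ) : ∀ r : ℤ,
      (G (n + 1) * H (m + (n + 1) + r) - G (n + 1 + r) * H (m + (n + 1)))
        + (G n * H (m + n + r) - G (n + r) * H (m + n)) = 0 := by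
    have key : ∀ r : ℤ,
        ((G (n + 1) * H (m + (n + 1) + r) - G (n + 1 + r) * H (m + (n + 1)))
          + (G n * H (m + n + r) - G (n + r) * H (m + n)) = 0) ∧
        ((G (n + 1) * H (m + (n + 1) + (r + 1)) - G (n + 1 + (r + 1)) * H (m + (n + 1)))
          + (G n * H (m + n + (r + 1)) - G (n + (r + 1)) * H (m + n)) = 0) := by
      intro r
      induction r using Int.induction_on with
      | zero =>
        have e1 := hGr n
        have e2 := hHr (m + n)
        constructor
        · simp only [add_zero]; ring
        · rw [show m + (n + 1) + (0 + 1) = m + n + 2 by ring,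
            show n + 1 + (0 + 1) = n + 2 by ring, e1, e2,
            show m + (n + 1) = m + n + 1 by ring, zero_add]
          ring
      | succ i ih =>
        refine ⟨ih.2, ?_⟩
        have e1 := hGr (n + i)
        have e2 := hGr (n + 1 + i)
        have e3 := hHr (m + n + i)
        have e4 := hHr (m + (n + 1) + i)
        simp only [add_assoc, one_add_one_eq_two] at *
        rw [e1, e2, e3, e4]
        linear_combination ih.1 + ih.2
      | pred i ih =>
        have e1 := hGr (n + (-i - 1))
        have e2 := hGr (n + 1 + (-i - 1))
        have e3 := hHr (m + n + (-i - 1))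
        have e4 := hHr (m + (n + 1) + (-i - 1))
        have h0 : (-(i : ℤ) - 1) + 1 = -i := by ring
        have h1 : (-(i : ℤ) - 1) + 2 = -i + 1 := by ring
        simp only [add_assoc, h0, h1] at *
        refine ⟨?_, ih.1⟩
        rw [e1, e2, e3, e4] at ih
        linear_combination ih.2 - ih.1
    exact fun r => (key r).1
  induction n using Int.induction_on with
  | zero => simp
  | succ i ih =>
    rw [zpow_add_one₀ (by norm_num)]
    linear_combination step i r - ih
  | pred i ih =>
    have h := step (-i - 1) r
    rw [sub_add_cancel] at h
    rw [zpow_sub_one₀ (by norm_num), inv_neg_one]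
    linear_combination h - ih

/-- Weighted double binomial sum identity for two generalized Fibonacci sequences. -/
theorem stmt_14 (G H : ℤ → ℝ)
    (hG : ∀ m : ℤ, G m = G (m - 1) + G (m - 2))
    (hH : ∀ m : ℤ, H m = H (m - 1) + H (m - 2))
    (m n r : ℤ) (hGn : G n ≠ 0) (k : ℕ) :
    ∑ j ∈ Finset.range (k + 1), ∑ s ∈ Finset.range (j + 1),
        (-1 : ℝ) ^ (n * ((j : ℤ) + s) + j) * (Nat.choose k j : ℝ)
          * (Nat.choose j s : ℝ)
          * (G 0 ^ (j - s) * G (n + r) ^ s / G n ^ j)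
          * H (m + (n + r) * k - n * j + (n - r) * s)
      = (-1 : ℝ) ^ ((n + 1) * (k : ℤ)) * (G r / G n) ^ k * H m := by
  set ε : ℝ := (-1 : ℝ) ^ n with hε
  have hεε : ε * ε = 1 := by
    rw [hε, ← mul_zpow]; simp
  set a : ℝ := -ε * G 0 / G n with ha
  set b : ℝ := -G (n + r) / G n with hb
  set c : ℝ := -ε * (G r / G n) with hc
  set A := b • shiftEnd n with hA
  set B := a • shiftEnd r with hB
  set C := shiftEnd (n + r) with hC
  have hT : (A + B + C) H = c • H := by
    ext x
    have h := fib_cross_identity G H hG hH x n r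
    simp only [hA, hB, hC, LinearMap.add_apply, LinearMap.smul_apply, Pi.add_apply,
      Pi.smul_apply, shiftEnd_apply, smul_eq_mul, ha, hb, hc]
    rw [← add_assoc x n r]
    field_simp
    linear_combination h
  have hTk : ((A + B + C) ^ k) H = c ^ k • H := by
    induction k with
    | zero => simp
    | succ k ih => rw [pow_succ, Module.End.mul_apply, hT, map_smul, ih, smul_smul, pow_succ']
  have hAB : Commute A B := ((shiftEnd_commute n r).smul_left b).smul_right a
  have hABC : Commute (A + B) C :=
    ((shiftEnd_commute n (n + r)).smul_left b).add_left ((shiftEnd_commute r (n + r)).smul_left a)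
  have hR : (-1 : ℝ) ^ ((n + 1) * (k : ℤ)) * (G r / G n) ^ k * H m = ((A + B + C) ^ k) H m := by
    rw [hTk, Pi.smul_apply, smul_eq_mul, hc, mul_pow, zpow_mul, zpow_natCast,
      zpow_add_one₀ (by norm_num), ← hε, mul_neg_one]
  rw [hR, hABC.add_pow, LinearMap.sum_apply, Finset.sum_apply]
  refine Finset.sum_congr rfl fun j hj => ?_
  have hjk : j ≤ k := Nat.lt_succ_iff.mp (Finset.mem_range.mp hj)
  rw [hAB.add_pow, Finset.sum_mul, Finset.sum_mul, LinearMap.sum_apply, Finset.sum_apply]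
  refine Finset.sum_congr rfl fun s hs => ?_
  have hsj : s ≤ j := Nat.lt_succ_iff.mp (Finset.mem_range.mp hs)
  have hop : A ^ s * B ^ (j - s) * (j.choose s : Module.End ℝ (ℤ → ℝ)) * C ^ (k - j)
        * (k.choose j : Module.End ℝ (ℤ → ℝ))
      = (b ^ s * a ^ (j - s) * j.choose s * k.choose j) •
        shiftEnd ((n + r) * k - n * j + (n - r) * s) := by
    have e : (n + r) * k - n * j + (n - r) * s
        = n * s + r * ((j - s : ℕ) : ℤ) + (n + r) * ((k - j : ℕ) : ℤ) := by
      push_cast [hsj, hjk]; ring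
    rw [e, ← shiftEnd_mul, ← shiftEnd_mul, ← shiftEnd_pow, ← shiftEnd_pow, ← shiftEnd_pow,
      hA, hB, hC, smul_pow, smul_pow, (Nat.cast_commute (k.choose j) _).symm.eq,
      (Nat.cast_commute (j.choose s) _).symm.eq, ← nsmul_eq_mul, ← nsmul_eq_mul]
    simp only [smul_mul_assoc, mul_smul_comm, ← Nat.cast_smul_eq_nsmul ℝ, smul_smul]
    congr 1
    ring
  have hsign : (-1 : ℝ) ^ (n * ((j : ℤ) + s) + j) * (G 0 ^ (j - s) * G (n + r) ^ s / G n ^ j)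
      = b ^ s * a ^ (j - s) := by
    obtain ⟨t, rfl⟩ := Nat.exists_eq_add_of_le hsj
    rw [Nat.add_sub_cancel_left, zpow_add₀ (by norm_num), zpow_mul, ← hε, ← Nat.cast_add,
      zpow_natCast, zpow_natCast, ha, hb, div_pow, div_pow, neg_pow (G (n + r)), mul_pow,
      neg_pow ε]
    have : ε ^ (s + t + s) = ε ^ t := by
      rw [show s + t + s = t + 2 * s by ring, pow_add, pow_mul, pow_two, hεε, one_pow, mul_one]
    rw [this]
    field_simp
    ring
  rw [hop, LinearMap.smul_apply, Pi.smul_apply, shiftEnd_apply, smul_eq_mul, ← hsign,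
    show m + ((n + r) * k - n * j + (n - r) * s) = m + (n + r) * k - n * j + (n - r) * s by ring]
  ring
end

section
/- Let G and H be generalized Fibonacci sequences. For all integers m, n, r with G(r) ≠ 0 and every nonnegative integer k: ∑_{j=0}^{k} ∑_{s=0}^{k−j} (-1)^{n·s+j+s} · C(k,j) · C(k−j,s) · (G(0)^j · G(n+r)^s / G(r)^{j+s}) · H(m−(n+r)·k+r·j+n·s) = (-1)^{(n+1)·k} · (G(n)/G(r))^k · H(m), where C(k,j) denotes the binomial coefficient. -/
/-- The shift `f ↦ f (· + d)` on real sequences indexed by `ℤ`. -/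
def seqShift (d : ℤ) : Module.End ℝ (ℤ → ℝ) := LinearMap.funLeft ℝ ℝ (· + d)

theorem seqShift_apply (d : ℤ) (f : ℤ → ℝ) (m : ℤ) : seqShift d f m = f (m + d) := rfl

theorem seqShift_mul (d e : ℤ) : seqShift d * seqShift e = seqShift (d + e) := by
  ext f m
  simp only [Module.End.mul_apply, seqShift_apply, add_assoc]

theorem seqShift_pow (d : ℤ) (j : ℕ) : seqShift d ^ j = seqShift (j * d) := by
  induction j with
  | zero => ext f m; simp [seqShift_apply]
  | succ j ih => rw [pow_succ, ih, seqShift_mul]; congr 1; push_cast; ring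

theorem commute_seqShift (d e : ℤ) : Commute (seqShift d) (seqShift e) := by
  rw [Commute, SemiconjBy, seqShift_mul, seqShift_mul, add_comm]

/-- A three-term shift relation `H (m + x) + a H (m + y) + b H (m + z) = c H m` iterates to a
trinomial sum. -/
theorem trinomial_sum_of_shift_relation (H : ℤ → ℝ) (a b c : ℝ) (x y z : ℤ)
    (h : ∀ m, H (m + x) + a * H (m + y) + b * H (m + z) = c * H m) (m : ℤ) (k : ℕ) :
    ∑ j ∈ Finset.range (k + 1), ∑ s ∈ Finset.range (k - j + 1),
        (k.choose j : ℝ) * ((k - j).choose s : ℝ) * (a ^ j * b ^ s)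
          * H (m + (j * y + (s * z + ((k - j - s : ℕ) : ℤ) * x)))
      = c ^ k * H m := by
  have hT : ((a • seqShift y + (b • seqShift z + seqShift x)) ^ k) H = c ^ k • H := by
    induction k with
    | zero => simp
    | succ k ih =>
      have h1 : (a • seqShift y + (b • seqShift z + seqShift x)) H = c • H := by
        ext m
        simp only [LinearMap.add_apply, LinearMap.smul_apply, Pi.add_apply, Pi.smul_apply,
          smul_eq_mul, seqShift_apply]
        linarith [h m]
      rw [pow_succ, Module.End.mul_apply, h1, map_smul, ih, smul_smul, pow_succ, mul_comm]
  have h2 : Commute (b • seqShift z) (seqShift x) := (commute_seqShift z x).smul_left b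
  have h3 : Commute (a • seqShift y) (b • seqShift z + seqShift x) :=
    (((commute_seqShift y z).smul_right b).add_right (commute_seqShift y x)).smul_left a
  have hm := congrFun hT m
  rw [h3.add_pow] at hm
  simp only [h2.add_pow, smul_pow, seqShift_pow, ← nsmul_eq_mul', Finset.mul_sum,
    Finset.smul_sum, LinearMap.sum_apply, Finset.sum_apply] at hm
  rw [Pi.smul_apply, smul_eq_mul] at hm
  rw [← hm]
  refine Finset.sum_congr rfl fun j _ => Finset.sum_congr rfl fun s _ => ?_
  simp only [← Nat.cast_smul_eq_nsmul ℝ, smul_mul_assoc, mul_smul_comm, seqShift_mul,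
    LinearMap.smul_apply, Pi.smul_apply, seqShift_apply, smul_eq_mul]
  ring

/-- A Vajda-type identity for two generalized Fibonacci sequences. -/
theorem fib_vajda (G H : ℤ → ℝ)
    (hG : ∀ m : ℤ, G m = G (m - 1) + G (m - 2))
    (hH : ∀ m : ℤ, H m = H (m - 1) + H (m - 2)) (n m r : ℤ) :
    G n * H (m + n) - G (n + r) * H (m + n - r)
      = (-1 : ℝ) ^ n * (G 0 * H m - G r * H (m - r)) := by
  have inv (r : ℤ) : ∀ n m, G (n + r + 1) * H (m - r + 1) + G (n + r) * H (m - r)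
      = G (n + 1) * H (m + 1) + G n * H m := by
    have step (n m : ℤ) : G (n + 1 + 1) * H (m - 1 + 1) + G (n + 1) * H (m - 1)
        = G (n + 1) * H (m + 1) + G n * H m := by
      have h1 := hG (n + 1 + 1)
      have h2 := hH (m + 1)
      rw [show n + 1 + 1 - 1 = n + 1 by ring, show n + 1 + 1 - 2 = n by ring] at h1
      rw [show m + 1 - 1 = m by ring, show m + 1 - 2 = m - 1 by ring] at h2
      rw [h1, h2, show m - 1 + 1 = m by ring]
      ring
    induction r with
    | zero => simp
    | succ i ih =>
      intro n m
      rw [← ih n m, ← step (n + i) (m - i)]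
      ring_nf
    | pred i ih =>
      intro n m
      rw [← ih n m, ← step (n + (-i - 1)) (m - (-i - 1))]
      ring_nf
  have key (n : ℤ) : G (n + 1) * H (m + (n + 1)) - G (n + 1 + r) * H (m + (n + 1) - r)
      = -(G n * H (m + n) - G (n + r) * H (m + n - r)) := by
    have h := inv r n (m + n)
    rw [show n + 1 + r = n + r + 1 by ring, show m + (n + 1) - r = m + n - r + 1 by ring,
      show m + (n + 1) = m + n + 1 by ring]
    linarith
  induction n with
  | zero => simp
  | succ i ih => rw [key, ih, zpow_add_one₀ (by norm_num)]; ring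
  | pred i ih =>
    have h := key (-i - 1)
    rw [show (-i - 1 + 1 : ℤ) = -i by ring, ih] at h
    rw [zpow_sub_one₀ (by norm_num), inv_neg_one]
    linarith

/-- Weighted double binomial sum identity for two generalized Fibonacci sequences. -/
theorem stmt_15 (G H : ℤ → ℝ)
    (hG : ∀ m : ℤ, G m = G (m - 1) + G (m - 2))
    (hH : ∀ m : ℤ, H m = H (m - 1) + H (m - 2))
    (m n r : ℤ) (hGr : G r ≠ 0) (k : ℕ) :
    ∑ j ∈ Finset.range (k + 1), ∑ s ∈ Finset.range (k - j + 1),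
        (-1 : ℝ) ^ (n * (s : ℤ) + j + s) * (Nat.choose k j : ℝ)
          * (Nat.choose (k - j) s : ℝ)
          * (G 0 ^ j * G (n + r) ^ s / G r ^ (j + s))
          * H (m - (n + r) * k + r * j + n * s)
      = (-1 : ℝ) ^ ((n + 1) * (k : ℤ)) * (G n / G r) ^ k * H m := by
  have hneg : (-1 : ℝ) ≠ 0 := by norm_num
  have rel (m : ℤ) : H (m + -(n + r)) + -1 * (G 0 / G r) * H (m + -n)
      + (-1 : ℝ) ^ (n + 1) * (G (n + r) / G r) * H (m + -r)
      = (-1 : ℝ) ^ (n + 1) * (G n / G r) * H m := by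
    have h := fib_vajda G H hG hH n (m - n) r
    have hsq : (-1 : ℝ) ^ n * (-1 : ℝ) ^ n = 1 := by
      rw [← mul_zpow]; norm_num
    rw [show m - n + n = m by ring] at h
    rw [show m + -(n + r) = m - n - r by ring, ← sub_eq_add_neg, ← sub_eq_add_neg,
      zpow_add_one₀ hneg]
    field_simp
    linear_combination (-1 : ℝ) ^ n * h + (G 0 * H (m - n) - G r * H (m - n - r)) * hsq
  rw [zpow_mul, zpow_natCast, ← mul_pow, ← trinomial_sum_of_shift_relation H _ _ _ _ _ _ rel m k]
  refine Finset.sum_congr rfl fun j hj => Finset.sum_congr rfl fun s hs => ?_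
  rw [Finset.mem_range] at hj hs
  have hidx : m - (n + r) * k + r * j + n * s
      = m + (j * -n + (s * -r + ((k - j - s : ℕ) : ℤ) * -(n + r))) := by
    rw [Nat.cast_sub (by omega), Nat.cast_sub (by omega)]
    ring
  have hsign : (-1 : ℝ) ^ (n * (s : ℤ) + j + s) = (-1) ^ j * ((-1 : ℝ) ^ (n + 1)) ^ s := by
    rw [← zpow_natCast, ← zpow_natCast, ← zpow_mul, ← zpow_add₀ hneg]
    congr 1
    ring
  rw [hidx, hsign, mul_pow, mul_pow, div_pow, div_pow, pow_add]
  field_simp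
end

section
/- Let G and H be generalized Fibonacci sequences. For all integers m, n, r with G(r) ≠ 0 and every nonnegative integer k: ∑_{j=0}^{k} ∑_{s=0}^{k−j} (-1)^{n·s+j} · C(k,j) · C(k−j,s) · (G(0)^j · G(n)^s / G(r)^{j+s}) · H(m−n·k+r·j+(n+r)·s) = (-1)^{n·k} · (G(n+r)/G(r))^k · H(m), where C(k,j) denotes the binomial coefficient. -/
theorem fib_eq_zero (F : ℤ → ℝ) (hF : ∀ m : ℤ, F m = F (m - 1) + F (m - 2))
    (h0 : F 0 = 0) (h1 : F 1 = 0) (m : ℤ) : F m = 0 := by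
  suffices h : F m = 0 ∧ F (m + 1) = 0 from h.1
  induction m using Int.induction_on with
  | zero => exact ⟨h0, by simpa using h1⟩
  | succ i ih =>
    refine ⟨ih.2, ?_⟩
    have h := hF ((i : ℤ) + 1 + 1)
    rw [show (i : ℤ) + 1 + 1 - 1 = i + 1 by ring, show (i : ℤ) + 1 + 1 - 2 = i by ring] at h
    rw [h, ih.1, ih.2, add_zero]
  | pred i ih =>
    have h := hF (-(i : ℤ) + 1)
    rw [show -(i : ℤ) + 1 - 1 = -i by ring, show -(i : ℤ) + 1 - 2 = -i - 1 by ring,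
      ih.1, ih.2] at h
    exact ⟨by linarith, by rw [sub_add_cancel]; exact ih.1⟩

/-- The Casoratian of two generalized Fibonacci sequences, up to sign, is constant. -/
theorem fib_casoratian (G H : ℤ → ℝ)
    (hG : ∀ m : ℤ, G m = G (m - 1) + G (m - 2))
    (hH : ∀ m : ℤ, H m = H (m - 1) + H (m - 2)) (p n : ℤ) :
    (-1 : ℝ) ^ n * (G (n + 1) * H (p + n) - G n * H (p + n + 1))
      = G 1 * H p - G 0 * H (p + 1) := by
  have step : ∀ n : ℤ,
      (-1 : ℝ) ^ (n + 1) * (G (n + 1 + 1) * H (p + (n + 1)) - G (n + 1) * H (p + (n + 1) + 1))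
        = (-1 : ℝ) ^ n * (G (n + 1) * H (p + n) - G n * H (p + n + 1)) := by
    intro n
    have hg := hG (n + 1 + 1)
    have hh := hH (p + (n + 1) + 1)
    rw [show n + 1 + 1 - 1 = n + 1 by ring, show n + 1 + 1 - 2 = n by ring] at hg
    rw [show p + (n + 1) + 1 - 1 = p + n + 1 by ring,
      show p + (n + 1) + 1 - 2 = p + n by ring] at hh
    rw [hg, hh, ← add_assoc p n 1, zpow_add_one₀ (by norm_num)]
    ring
  induction n using Int.induction_on with
  | zero => simp
  | succ i ih => rw [step, ih]
  | pred i ih =>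
    have h := step (-(i : ℤ) - 1)
    rw [show -(i : ℤ) - 1 + 1 = -i by ring, ih] at h
    rw [sub_add_cancel, h]

theorem fib_three_term (G H : ℤ → ℝ)
    (hG : ∀ m : ℤ, G m = G (m - 1) + G (m - 2))
    (hH : ∀ m : ℤ, H m = H (m - 1) + H (m - 2)) (p n r : ℤ) :
    G r * H p + (-1 : ℝ) ^ n * G n * H (p + n + r) - G 0 * H (p + r)
      = (-1 : ℝ) ^ n * G (n + r) * H (p + n) := by
  rw [← sub_eq_zero]
  refine fib_eq_zero (fun r => G r * H p + (-1 : ℝ) ^ n * G n * H (p + n + r) - G 0 * H (p + r)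
      - (-1 : ℝ) ^ n * G (n + r) * H (p + n)) (fun r => ?_) ?_ ?_ r
  · simp only [← add_sub_assoc]
    rw [hG r, hG (n + r), hH (p + n + r), hH (p + r)]
    ring
  · simp
  · linear_combination -fib_casoratian G H hG hH p n

theorem zpow_fib {x : ℝ} (hx : x ≠ 0) (h : x ^ 2 = x + 1) (m : ℤ) :
    x ^ m = x ^ (m - 1) + x ^ (m - 2) := by
  have h1 : x ^ m = x ^ (m - 2) * x ^ 2 := by
    rw [← zpow_natCast x 2, ← zpow_add₀ hx]; congr 1; push_cast; ring
  have h2 : x ^ (m - 1) = x ^ (m - 2) * x := by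
    rw [← zpow_add_one₀ hx]; congr 1; ring
  rw [h1, h2, h]; ring

theorem add_add_pow_eq_sum (a b c : ℝ) (k : ℕ) :
    (b + (c + a)) ^ k = ∑ j ∈ Finset.range (k + 1), ∑ s ∈ Finset.range (k - j + 1),
      (k.choose j : ℝ) * ((k - j).choose s : ℝ) * (b ^ j * c ^ s * a ^ (k - j - s)) := by
  rw [add_pow]
  refine Finset.sum_congr rfl fun j _ => ?_
  rw [add_pow, Finset.mul_sum, Finset.sum_mul]
  exact Finset.sum_congr rfl fun s _ => by ring

theorem zpow_double_sum (G : ℤ → ℝ) (hG : ∀ m : ℤ, G m = G (m - 1) + G (m - 2))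
    {x : ℝ} (hx : x ≠ 0) (h : x ^ 2 = x + 1) (m n r : ℤ) (hGr : G r ≠ 0) (k : ℕ) :
    ∑ j ∈ Finset.range (k + 1), ∑ s ∈ Finset.range (k - j + 1),
        (-1 : ℝ) ^ (n * (s : ℤ) + j) * (Nat.choose k j : ℝ)
          * (Nat.choose (k - j) s : ℝ)
          * (G 0 ^ j * G n ^ s / G r ^ (j + s))
          * x ^ (m - n * k + r * j + (n + r) * s)
      = (-1 : ℝ) ^ (n * (k : ℤ)) * (G (n + r) / G r) ^ k * x ^ m := by
  have key := fib_three_term G (fun i => x ^ i) hG (zpow_fib hx h) (-n) n r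
  simp only [neg_add_cancel, zero_add, zpow_zero, mul_one] at key
  have base : (-1 : ℝ) ^ n * (G (n + r) / G r)
      = -(G 0 / G r) * x ^ (r - n) + ((-1 : ℝ) ^ n * (G n / G r) * x ^ r + x ^ (-n)) := by
    rw [show r - n = -n + r by ring]
    field_simp
    linear_combination -key
  rw [zpow_mul, zpow_natCast, ← mul_pow, base, add_add_pow_eq_sum, Finset.sum_mul]
  refine Finset.sum_congr rfl fun j hj => ?_
  rw [Finset.sum_mul]
  refine Finset.sum_congr rfl fun s hs => ?_
  have hj' : j ≤ k := by simpa [Nat.lt_succ_iff] using hj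
  have hs' : s ≤ k - j := by simpa [Nat.lt_succ_iff] using hs
  have hexp : x ^ (m - n * k + r * j + (n + r) * s)
      = (x ^ (r - n)) ^ j * (x ^ r) ^ s * (x ^ (-n)) ^ (k - j - s) * x ^ m := by
    simp only [← zpow_natCast, ← zpow_mul, ← zpow_add₀ hx]
    congr 1
    rw [Nat.cast_sub hs', Nat.cast_sub hj']
    ring
  rw [hexp, zpow_add₀ (by norm_num), zpow_mul, zpow_natCast, zpow_natCast, pow_add,
    neg_mul, neg_pow (G 0 / G r * _), mul_pow, mul_pow, mul_pow, div_pow, div_pow]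
  field_simp

theorem fib_eq_binet (H : ℤ → ℝ) (hH : ∀ m : ℤ, H m = H (m - 1) + H (m - 2)) :
    ∃ A B : ℝ, ∀ m : ℤ, H m = A * Real.goldenRatio ^ m + B * Real.goldenConj ^ m := by
  have h5 : Real.goldenRatio - Real.goldenConj ≠ 0 := by
    rw [Real.goldenRatio_sub_goldenConj]; positivity
  refine ⟨(H 1 - H 0 * Real.goldenConj) / (Real.goldenRatio - Real.goldenConj),
    (H 0 * Real.goldenRatio - H 1) / (Real.goldenRatio - Real.goldenConj), fun m => ?_⟩
  rw [← sub_eq_zero]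
  refine fib_eq_zero (fun m => H m -
    ((H 1 - H 0 * Real.goldenConj) / (Real.goldenRatio - Real.goldenConj) * Real.goldenRatio ^ m
      + (H 0 * Real.goldenRatio - H 1) / (Real.goldenRatio - Real.goldenConj)
        * Real.goldenConj ^ m)) (fun m => ?_) ?_ ?_ m
  · rw [hH m, zpow_fib Real.goldenRatio_ne_zero Real.goldenRatio_sq m,
      zpow_fib Real.goldenConj_ne_zero Real.goldenConj_sq m]
    ring
  · simp only [zpow_zero]
    field_simp
    ring
  · simp only [zpow_one]
    field_simp
    ring


/-- Weighted double binomial sum identity for two generalized Fibonacci sequences. -/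
theorem stmt_16 (G H : ℤ → ℝ)
    (hG : ∀ m : ℤ, G m = G (m - 1) + G (m - 2))
    (hH : ∀ m : ℤ, H m = H (m - 1) + H (m - 2))
    (m n r : ℤ) (hGr : G r ≠ 0) (k : ℕ) :
    ∑ j ∈ Finset.range (k + 1), ∑ s ∈ Finset.range (k - j + 1),
        (-1 : ℝ) ^ (n * (s : ℤ) + j) * (Nat.choose k j : ℝ)
          * (Nat.choose (k - j) s : ℝ)
          * (G 0 ^ j * G n ^ s / G r ^ (j + s))
          * H (m - n * k + r * j + (n + r) * s)
      = (-1 : ℝ) ^ (n * (k : ℤ)) * (G (n + r) / G r) ^ k * H m := by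
  obtain ⟨A, B, hAB⟩ := fib_eq_binet H hH
  simp only [hAB, mul_add, mul_left_comm _ A, mul_left_comm _ B, Finset.sum_add_distrib,
    ← Finset.mul_sum]
  rw [← zpow_double_sum G hG Real.goldenRatio_ne_zero Real.goldenRatio_sq m n r hGr k,
    ← zpow_double_sum G hG Real.goldenConj_ne_zero Real.goldenConj_sq m n r hGr k]
end
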